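/- Let P be a probability measure on Ω = Σ^ℕ. Then for all n ≥ 1 and t ≥ 1: (1/n)·Σ_{i=0}^{n−1} H^t(P∘T^{−i}) ≤ H^t(P_n) ≤ (1/n)·Σ_{i=0}^{n−1} H^t(P∘T^{−i}) + (n/t)·log 2, where P_n := (1/n)·Σ_{i=0}^{n−1} P∘T^{−i}. -/

import Mathlib

open MeasureTheory Filter
open scoped ENNReal

variable {α : Type*}

/-- The cylinder set of sequences in `Ω = Σ^ℕ` whose first `t` symbols are `v`. -/
def cylinder (t : ℕ) (v : Fin t → α) : Set (ℕ → α) :=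
  {ω | ∀ i : Fin t, ω (i : ℕ) = v i}

variable [Fintype α] [Nonempty α] [MeasurableSpace α] [DiscreteMeasurableSpace α]

/-- `P(v)`, the probability that the source emits the word `v`. -/
noncomputable def wordProb (P : Measure (ℕ → α)) {t : ℕ} (v : Fin t → α) : ℝ :=
  (P (cylinder t v)).toReal

/-- `H^t(P)`, the entropy of the induced distribution on words of length `t`, divided
by `t` (natural logarithm; the convention `0 · log 0 = 0` holds since `Real.log 0 = 0`). -/
noncomputable def Hn (P : Measure (ℕ → α)) (t : ℕ) : ℝ :=
  -(1 / (t : ℝ)) * ∑ v : Fin t → α, wordProb P v * Real.log (wordProb P v)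

/-- `d_{TV,t}(P,Q) = Σ_{v ∈ Σ^t} |P(v) − Q(v)|`. -/
noncomputable def dTVt (P Q : Measure (ℕ → α)) (t : ℕ) : ℝ :=
  ∑ v : Fin t → α, |wordProb P v - wordProb Q v|

/-- `d_TV(P,Q) = sup_{t ∈ ℕ} d_{TV,t}(P,Q)`. -/
noncomputable def dTV (P Q : Measure (ℕ → α)) : ℝ := ⨆ t : ℕ, dTVt P Q t

/-- The shift operator `T` on `Ω = Σ^ℕ`: `T(v₀v₁v₂…) = v₁v₂…`. -/
def shift : (ℕ → α) → (ℕ → α) := fun ω n => ω (n + 1)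

/-- `P_n := (1/n) Σ_{i=0}^{n−1} P ∘ T^{−i}` (as a measure on `Ω`). -/
noncomputable def cesaroAvg (P : Measure (ℕ → α)) (n : ℕ) : Measure (ℕ → α) :=
  (n : ℝ≥0∞)⁻¹ • ∑ i ∈ Finset.range n, P.map (shift^[i])

/-- `P_n := (1/n) Σ_{i=0}^{n−1} P ∘ T^{−i}`, as a finite signed measure on `Ω`. -/
noncomputable def cesaroAvgS (P : Measure (ℕ → α)) [IsFiniteMeasure P] (n : ℕ) :
    SignedMeasure (ℕ → α) :=
  (n : ℝ)⁻¹ • ∑ i ∈ Finset.range n, (P.toSignedMeasure).map (shift^[i])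

theorem measurable_shift {β : Type*} [MeasurableSpace β] :
    Measurable (shift : (ℕ → β) → (ℕ → β)) :=
  measurable_pi_lambda _ fun n => measurable_pi_apply (n + 1)

theorem wordProb_nonneg {β : Type*} [MeasurableSpace β]
    (P : Measure (ℕ → β)) {t : ℕ} (v : Fin t → β) : 0 ≤ wordProb P v :=
  ENNReal.toReal_nonneg

theorem sum_wordProb {β : Type*} [Fintype β] [MeasurableSpace β] [DiscreteMeasurableSpace β]
    (P : Measure (ℕ → β)) [IsProbabilityMeasure P] (t : ℕ) :
    ∑ v : Fin t → β, wordProb P v = 1 := by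
  have hcyl (v : Fin t → β) :
      cylinder t v = (fun (ω : ℕ → β) (i : Fin t) => ω i) ⁻¹' {v} := by
    ext ω
    simp [_root_.cylinder, funext_iff]
  have hmeas : Measurable fun (ω : ℕ → β) (i : Fin t) => ω i :=
    measurable_pi_lambda _ fun i => measurable_pi_apply (i : ℕ)
  have hsum := sum_measure_preimage_singleton (μ := P) (f := fun (ω : ℕ → β) (i : Fin t) => ω i)
    Finset.univ fun v _ => hmeas (measurableSet_singleton v)
  simp only [wordProb, hcyl]
  rw [← ENNReal.toReal_sum fun v _ => measure_ne_top P _, hsum]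
  simp

theorem wordProb_cesaroAvg {β : Type*} [MeasurableSpace β]
    (P : Measure (ℕ → β)) [IsProbabilityMeasure P] (n : ℕ) {t : ℕ}
    (v : Fin t → β) :
    wordProb (cesaroAvg P n) v =
      ∑ i ∈ Finset.range n, (n : ℝ)⁻¹ * wordProb (P.map (shift^[i])) v := by
  simp only [wordProb, cesaroAvg, Measure.smul_apply, Measure.finsetSum_apply, smul_eq_mul,
    ENNReal.toReal_mul, ENNReal.toReal_inv, ENNReal.toReal_natCast]
  rw [ENNReal.toReal_sum fun i _ => measure_ne_top _ _, Finset.mul_sum]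

theorem Hn_eq_sum_negMulLog {β : Type*} [Fintype β] [MeasurableSpace β]
    (P : Measure (ℕ → β)) (t : ℕ) :
    Hn P t = (1 / (t : ℝ)) * ∑ v : Fin t → β, Real.negMulLog (wordProb P v) := by
  simp [Hn, Real.negMulLog, Finset.sum_neg_distrib]

theorem Real.negMulLog_sum_le {ι : Type*} (s : Finset ι) (x : ι → ℝ) (hx : ∀ i ∈ s, 0 ≤ x i) :
    Real.negMulLog (∑ i ∈ s, x i) ≤ ∑ i ∈ s, Real.negMulLog (x i) := by
  simp only [Real.negMulLog, neg_mul, Finset.sum_neg_distrib, Finset.sum_mul]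
  refine neg_le_neg (Finset.sum_le_sum fun i hi => ?_)
  rcases (hx i hi).eq_or_lt with h | h
  · simp [← h]
  · exact mul_le_mul_of_nonneg_left
      (Real.log_le_log h (Finset.single_le_sum hx hi)) h.le

theorem Real.log_natCast_le_mul_log_two (n : ℕ) : Real.log n ≤ n * Real.log 2 := by
  rcases n.eq_zero_or_pos with rfl | hn
  · simp
  · rw [← Real.log_pow]
    exact Real.log_le_log (by exact_mod_cast hn) (by exact_mod_cast n.lt_two_pow_self.le)

theorem le_sum_negMulLog_wordProb_cesaroAvg {β : Type*} [Fintype β] [MeasurableSpace β]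
    (P : Measure (ℕ → β)) [IsProbabilityMeasure P]
    {n : ℕ} (hn : n ≠ 0) (t : ℕ) :
    (n : ℝ)⁻¹ * ∑ i ∈ Finset.range n,
        ∑ v : Fin t → β, Real.negMulLog (wordProb (P.map (shift^[i])) v) ≤
      ∑ v : Fin t → β, Real.negMulLog (wordProb (cesaroAvg P n) v) := by
  rw [Finset.sum_comm, Finset.mul_sum]
  refine Finset.sum_le_sum fun v _ => ?_
  rw [wordProb_cesaroAvg, Finset.mul_sum]
  have hnR : (n : ℝ) ≠ 0 := by exact_mod_cast hn
  exact Real.concaveOn_negMulLog.le_map_sum (t := Finset.range n) (w := fun _ => (n : ℝ)⁻¹)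
    (p := fun i => wordProb (P.map (shift^[i])) v) (fun _ _ => by positivity)
    (by simp [hnR]) fun i _ => wordProb_nonneg _ _

theorem sum_negMulLog_wordProb_cesaroAvg_le {β : Type*} [Fintype β] [MeasurableSpace β]
    [DiscreteMeasurableSpace β]
    (P : Measure (ℕ → β)) [IsProbabilityMeasure P]
    {n : ℕ} (hn : n ≠ 0) (t : ℕ) :
    ∑ v : Fin t → β, Real.negMulLog (wordProb (cesaroAvg P n) v) ≤
      (n : ℝ)⁻¹ * ∑ i ∈ Finset.range n,
        ∑ v : Fin t → β, Real.negMulLog (wordProb (P.map (shift^[i])) v) + Real.log n := by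
  have hnR : (n : ℝ) ≠ 0 := by exact_mod_cast hn
  have hprob (i : ℕ) : IsProbabilityMeasure (P.map (shift^[i])) :=
    Measure.isProbabilityMeasure_map (measurable_shift.iterate i).aemeasurable
  calc ∑ v : Fin t → β, Real.negMulLog (wordProb (cesaroAvg P n) v)
      ≤ ∑ v : Fin t → β, ∑ i ∈ Finset.range n,
          Real.negMulLog ((n : ℝ)⁻¹ * wordProb (P.map (shift^[i])) v) := by
        refine Finset.sum_le_sum fun v _ => ?_
        rw [wordProb_cesaroAvg]
        exact Real.negMulLog_sum_le _ _ fun i _ =>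
          mul_nonneg (by positivity) (wordProb_nonneg _ _)
    _ = ∑ i ∈ Finset.range n, ((n : ℝ)⁻¹ *
          ∑ v : Fin t → β, Real.negMulLog (wordProb (P.map (shift^[i])) v) +
            (n : ℝ)⁻¹ * Real.log n) := by
        rw [Finset.sum_comm]
        refine Finset.sum_congr rfl fun i _ => ?_
        simp only [Real.negMulLog_mul, Finset.sum_add_distrib, ← Finset.mul_sum,
          ← Finset.sum_mul, sum_wordProb]
        simp only [Real.negMulLog, Real.log_inv]
        ring
    _ = _ := by
        rw [Finset.sum_add_distrib, ← Finset.mul_sum]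
        simp [hnR]

/-- For every `n ≥ 1` and `t ≥ 1`:
`(1/n) Σ_{i<n} H^t(P∘T^{−i}) ≤ H^t(P_n) ≤ (1/n) Σ_{i<n} H^t(P∘T^{−i}) + (n/t)·log 2`. -/
theorem Hn_cesaroAvg_bounds (P : Measure (ℕ → α)) [IsProbabilityMeasure P]
    (n : ℕ) (hn : 1 ≤ n) (t : ℕ) (ht : 1 ≤ t) :
    (1 / (n : ℝ)) * ∑ i ∈ Finset.range n, Hn (P.map (shift^[i])) t
        ≤ Hn (cesaroAvg P n) t ∧
    Hn (cesaroAvg P n) t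
        ≤ (1 / (n : ℝ)) * ∑ i ∈ Finset.range n, Hn (P.map (shift^[i])) t
            + ((n : ℝ) / (t : ℝ)) * Real.log 2 := by
  have hn0 : n ≠ 0 := by omega
  have ht0 : (0 : ℝ) ≤ 1 / (t : ℝ) := by positivity
  simp only [Hn_eq_sum_negMulLog, ← Finset.mul_sum]
  have hlower := mul_le_mul_of_nonneg_left (le_sum_negMulLog_wordProb_cesaroAvg P hn0 t) ht0
  have hupper := mul_le_mul_of_nonneg_left
    ((sum_negMulLog_wordProb_cesaroAvg_le P hn0 t).trans
      (add_le_add_right (Real.log_natCast_le_mul_log_two n) _)) ht0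
  constructor
  · exact le_of_eq_of_le (by ring) hlower
  · exact hupper.trans_eq (by ring)
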